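/- For any n×n complex matrices f, h, J, with ⟨X,Y⟩ = Re tr(XY), X⁺ = (X − X*)/2 and X⁻ = (X + X*)/2, the following identity holds: ⟨(Jf)⁻, (hJ)⁻⟩ + ⟨(fJ)⁺, (Jh)⁺⟩ − ⟨(Jh)⁻, (fJ)⁻⟩ − ⟨(hJ)⁺, (Jf)⁺⟩ = 4⟨f⁺, (J⁺h⁺J⁻)⁺⟩ + 4⟨f⁻, (J⁻h⁻J⁺)⁻⟩. -/

import Mathlib

open Matrix Complex

noncomputable section

/-- `𝒢 = gl(n,ℂ)`. -/
abbrev Mat (n : ℕ) := Matrix (Fin n) (Fin n) ℂ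

variable {n : ℕ}

/-- The real trace form `⟨X,Y⟩ = Re tr(XY)`. -/
def ip (X Y : Mat n) : ℝ := ((X * Y).trace).re

/-- Anti-Hermitian part `X⁺ = (X - X*)/2`. -/
def ahPart (X : Mat n) : Mat n := (2⁻¹ : ℂ) • (X - Xᴴ)

/-- Hermitian part `X⁻ = (X + X*)/2`. -/
def hPart (X : Mat n) : Mat n := (2⁻¹ : ℂ) • (X + Xᴴ)

end

theorem re_tr_conj {n : ℕ} (X : Mat n) : (Xᴴ.trace).re = (X.trace).re := by
  rw [Matrix.trace_conjTranspose]; simp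

/-- For any `n×n` complex matrices `f, h, J`:
`⟨(Jf)⁻,(hJ)⁻⟩ + ⟨(fJ)⁺,(Jh)⁺⟩ − ⟨(Jh)⁻,(fJ)⁻⟩ − ⟨(hJ)⁺,(Jf)⁺⟩
  = 4⟨f⁺,(J⁺h⁺J⁻)⁺⟩ + 4⟨f⁻,(J⁻h⁻J⁺)⁻⟩`. -/
theorem statement19 (n : ℕ) (f h J : Mat n) :
    ip (hPart (J * f)) (hPart (h * J)) + ip (ahPart (f * J)) (ahPart (J * h))
      - ip (hPart (J * h)) (hPart (f * J)) - ip (ahPart (h * J)) (ahPart (J * f))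
    = 4 * ip (ahPart f) (ahPart (ahPart J * ahPart h * hPart J))
      + 4 * ip (hPart f) (hPart (hPart J * hPart h * ahPart J)) := by
  have c1 : ∀ g x y z : Mat n, (x * (g * (y * z))).trace = (g * (y * (z * x))).trace := by
    intro g x y z; rw [Matrix.trace_mul_comm]; simp only [Matrix.mul_assoc]
  have c2 : ∀ g x y z : Mat n, (x * (y * (g * z))).trace = (g * (z * (x * y))).trace := by
    intro g x y z; rw [← Matrix.mul_assoc, Matrix.trace_mul_comm]; simp only [Matrix.mul_assoc]
  have c3 : ∀ g x y z : Mat n, (x * (y * (z * g))).trace = (g * (x * (y * z))).trace := by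
    intro g x y z; rw [← Matrix.mul_assoc, ← Matrix.mul_assoc, Matrix.trace_mul_comm]
    simp only [Matrix.mul_assoc]
  have c4 : ∀ x y z : Mat n, (fᴴ * (x * (y * z))).trace.re
      = (f * (zᴴ * (yᴴ * xᴴ))).trace.re := by
    intro x y z
    rw [← re_tr_conj, ← c3]
    simp only [Matrix.conjTranspose_mul, Matrix.conjTranspose_conjTranspose, Matrix.mul_assoc]
  have r : ∀ X : Mat n, ((2⁻¹ : ℂ) • X) = ((2⁻¹ : ℝ) • X) := by
    intro X; ext i j; simp
  simp only [ip, ahPart, hPart, r, Matrix.conjTranspose_smul, star_trivial,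
    Matrix.conjTranspose_mul, Matrix.conjTranspose_add, Matrix.conjTranspose_sub,
    Matrix.conjTranspose_conjTranspose,
    Matrix.mul_add, Matrix.add_mul, Matrix.mul_sub, Matrix.sub_mul, smul_add, smul_sub,
    Matrix.smul_mul, Matrix.mul_smul, smul_smul, Matrix.mul_assoc,
    Matrix.trace_add, Matrix.trace_sub, Matrix.trace_smul, Complex.add_re, Complex.sub_re,
    Complex.real_smul, Complex.re_ofReal_mul,
    c1 f, c2 f, c3 f, c1 fᴴ, c2 fᴴ, c3 fᴴ, c4]
  ring
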